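/- arXiv:1807.03086 — 4 statements merged into one kernel-verified Lean document; each statement's English description precedes it below -/
import Mathlib

section
/- Let K be a field of characteristic 0 and g a nontrivial finite-dimensional semisimple Lie algebra over K with Killing form κ. Then there is no Lie algebra derivation D : g → g with κ(Dx,y) + κ(x,Dy) = 2·κ(x,y) for all x,y ∈ g, and consequently there is no alternating bilinear form θ : g × g → K with κ(x,⁅y,z⁆) = θ(⁅x,y⁆,z) − θ(⁅x,z⁆,y) + θ(⁅y,z⁆,x) for all x,y,z ∈ g; that is, g with its Killing form is Cartan-3-regular. -/
open LieAlgebra LinearMap in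
/-- Derivations are skew-adjoint for the Killing form. -/
theorem killingForm_leibniz_apply_add_eq_zero
    {R L : Type*} [CommRing R] [LieRing L] [LieAlgebra R L]
    (D : L →ₗ[R] L) (hD : ∀ x y : L, D ⁅x, y⁆ = ⁅D x, y⁆ + ⁅x, D y⁆) (x y : L) :
    killingForm R L (D x) y + killingForm R L x (D y) = 0 := by
  have had (z : L) : ad R L (D z) = D * ad R L z - ad R L z * D := by
    ext w
    simp [hD]
  rw [killingForm_apply_apply, killingForm_apply_apply, had, had,
    ← Module.End.mul_eq_comp, ← Module.End.mul_eq_comp, ← map_add]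
  have hcomm : (D * ad R L x - ad R L x * D) * ad R L y
      + ad R L x * (D * ad R L y - ad R L y * D)
      = D * (ad R L x * ad R L y) - (ad R L x * ad R L y) * D := by
    noncomm_ring
  rw [hcomm, map_sub, trace_mul_comm, sub_self]

/-- For a Lie algebra over a field with nondegenerate Killing form, a primitive of the Cartan
3-cocycle yields a derivation whose Killing-symmetric part is the identity. -/
theorem exists_leibniz_of_killingForm_lie_eq_coboundary
    {K L : Type*} [Field K] [LieRing L] [LieAlgebra K L] [Module.Finite K L]
    [LieAlgebra.IsKilling K L] (θ : L →ₗ[K] L →ₗ[K] K) (hθ : ∀ x : L, θ x x = 0)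
    (h : ∀ x y z : L, killingForm K L x ⁅y, z⁆ = θ ⁅x, y⁆ z - θ ⁅x, z⁆ y + θ ⁅y, z⁆ x) :
    ∃ D : L →ₗ[K] L, (∀ x y : L, D ⁅x, y⁆ = ⁅D x, y⁆ + ⁅x, D y⁆) ∧
      ∀ x y : L, killingForm K L (D x) y + killingForm K L x (D y)
        = 2 * killingForm K L x y := by
  have hnd := LieAlgebra.IsKilling.killingForm_nondegenerate K L
  have hcomm := LieModule.traceForm_comm K L L
  have hinv := LieModule.traceForm_apply_lie_apply K L L
  let E : L →ₗ[K] L := LinearMap.BilinForm.symmCompOfNondegenerate θ (killingForm K L) hnd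
  have hE (x y : L) : killingForm K L (E x) y = θ x y :=
    LinearMap.BilinForm.symmCompOfNondegenerate_left_apply θ hnd y x
  have hskew (x y : L) : killingForm K L (E x) y + killingForm K L x (E y) = 0 := by
    have hxy := hθ (x + y)
    simp only [map_add, LinearMap.add_apply, hθ, zero_add, add_zero] at hxy
    rw [hcomm x, hE, hE, add_comm, hxy]
  refine ⟨E + LinearMap.id, fun x y ↦ ?_, fun x y ↦ ?_⟩
  · rw [← sub_eq_zero]
    refine hnd.1 _ fun z ↦ ?_
    have hxyz := h x y z
    rw [← hinv, ← hE, ← hE, ← hE] at hxyz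
    have hxz : killingForm K L (E ⁅x, z⁆) y = killingForm K L ⁅x, E y⁆ z := by
      rw [eq_neg_of_add_eq_zero_left (hskew _ _), LieModule.traceForm_apply_lie_apply', neg_neg,
        hcomm]
    have hyz : killingForm K L (E ⁅y, z⁆) x = -killingForm K L ⁅E x, y⁆ z := by
      rw [eq_neg_of_add_eq_zero_left (hskew _ _), hcomm, hinv]
    simp only [LinearMap.add_apply, LinearMap.id_apply, add_lie, lie_add, map_add, map_sub,
      LinearMap.sub_apply]
    linear_combination -hxyz + hxz - hyz
  · simp only [LinearMap.add_apply, LinearMap.id_apply, map_add]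
    linear_combination hskew x y

/-- A nontrivial finite-dimensional semisimple Lie algebra over a field of
characteristic zero, equipped with its Killing form, is Cartan-3-regular:
there is no derivation whose Killing-symmetric part is the identity, and
consequently the Cartan 3-cocycle `Ω(x,y,z) = κ(x,⁅y,z⁆)` is not a
Chevalley–Eilenberg coboundary of any alternating bilinear form. -/
theorem semisimple_is_cartan_three_regular
    (K : Type*) [Field K] [CharZero K]
    (g : Type*) [LieRing g] [LieAlgebra K g] [Module.Finite K g]
    [LieAlgebra.IsSemisimple K g] [Nontrivial g] :
    (¬ ∃ D : g →ₗ[K] g, (∀ x y : g, D ⁅x, y⁆ = ⁅D x, y⁆ + ⁅x, D y⁆) ∧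
        ∀ x y : g, killingForm K g (D x) y + killingForm K g x (D y)
          = 2 * killingForm K g x y) ∧
    (¬ ∃ θ : g →ₗ[K] g →ₗ[K] K, (∀ x : g, θ x x = 0) ∧
        ∀ x y z : g, killingForm K g x ⁅y, z⁆
          = θ ⁅x, y⁆ z - θ ⁅x, z⁆ y + θ ⁅y, z⁆ x) := by
  have hno : ¬ ∃ D : g →ₗ[K] g, (∀ x y : g, D ⁅x, y⁆ = ⁅D x, y⁆ + ⁅x, D y⁆) ∧
      ∀ x y : g, killingForm K g (D x) y + killingForm K g x (D y)
        = 2 * killingForm K g x y := by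
    rintro ⟨D, hD, hκ⟩
    obtain ⟨x, hx⟩ := exists_ne (0 : g)
    refine hx ((LieAlgebra.IsKilling.killingForm_nondegenerate K g).1 x fun y ↦ ?_)
    simpa [killingForm_leibniz_apply_add_eq_zero D hD] using (hκ x y).symm
  exact ⟨hno, fun ⟨θ, hθ, h⟩ ↦ hno (exists_leibniz_of_killingForm_lie_eq_coboundary θ hθ h)⟩
end

section
/- Let K be a field of characteristic 0, z a finite-dimensional abelian Lie algebra over K equipped with a nondegenerate symmetric bilinear form B, and l a nontrivial finite-dimensional semisimple Lie algebra over K with Killing form κ_l. On the product Lie algebra g = z × l define κ((z₁,l₁),(z₂,l₂)) := B(z₁,z₂) + κ_l(l₁,l₂). Then κ is a nondegenerate invariant symmetric bilinear form on g, and there is no alternating bilinear form θ : g × g → K with κ(x,⁅y,z⁆) = θ(⁅x,y⁆,z) − θ(⁅x,z⁆,y) + θ(⁅y,z⁆,x) for all x,y,z ∈ g; that is, the (nonabelian reductive) quadratic Lie algebra (g,κ) is Cartan-3-regular. -/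
/-- The product (direct sum) Lie ring of two Lie rings. -/
instance prodLieRing (z l : Type*) [LieRing z] [LieRing l] : LieRing (z × l) where
  bracket p q := (⁅p.1, q.1⁆, ⁅p.2, q.2⁆)
  add_lie x y w := Prod.ext (add_lie x.1 y.1 w.1) (add_lie x.2 y.2 w.2)
  lie_add x y w := Prod.ext (lie_add x.1 y.1 w.1) (lie_add x.2 y.2 w.2)
  lie_self x := Prod.ext (lie_self x.1) (lie_self x.2)
  leibniz_lie x y w := Prod.ext (leibniz_lie x.1 y.1 w.1) (leibniz_lie x.2 y.2 w.2)

/-- The product (direct sum) Lie algebra of two Lie algebras. -/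
instance prodLieAlgebra (K : Type*) [CommRing K] (z l : Type*) [LieRing z] [LieRing l]
    [LieAlgebra K z] [LieAlgebra K l] : LieAlgebra K (z × l) where
  lie_smul c x y := Prod.ext (lie_smul c x.1 y.1) (lie_smul c x.2 y.2)

/-- On a Lie algebra with nondegenerate Killing form over a field in which `2` is invertible, the
Cartan 3-cocycle is the coboundary of an alternating form only if the algebra is trivial. -/
theorem LieAlgebra.IsKilling.subsingleton_of_killingForm_eq_coboundary
    {K l : Type*} [Field K] [NeZero (2 : K)] [LieRing l] [LieAlgebra K l] [Module.Finite K l]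
    [LieAlgebra.IsKilling K l] (θ : l →ₗ[K] l →ₗ[K] K) (hθ : ∀ x, θ x x = 0)
    (h : ∀ x y w : l, killingForm K l x ⁅y, w⁆ = θ ⁅x, y⁆ w - θ ⁅x, w⁆ y + θ ⁅y, w⁆ x) :
    Subsingleton l := by
  have hnd := LieAlgebra.IsKilling.killingForm_nondegenerate K l
  have hinv : ∀ x y w : l, killingForm K l ⁅x, y⁆ w = killingForm K l x ⁅y, w⁆ :=
    LieModule.traceForm_apply_lie_apply K l l
  have hinv' : ∀ x y w : l, killingForm K l ⁅x, y⁆ w = -killingForm K l y ⁅x, w⁆ :=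
    LieModule.traceForm_apply_lie_apply' K l l
  have hcomm : ∀ x y : l, killingForm K l x y = killingForm K l y x :=
    LieModule.traceForm_comm K l l
  have hskew : ∀ x y, θ x y = -θ y x := fun x y ↦ (LinearMap.IsAlt.neg hθ y x).symm
  -- Represent `θ` by a skew endomorphism `A`; then `A + id` is a derivation, hence inner.
  let A : l →ₗ[K] l := LinearMap.BilinForm.symmCompOfNondegenerate θ (killingForm K l) hnd
  have hA : ∀ x y, killingForm K l (A x) y = θ x y := fun x y ↦
    LinearMap.BilinForm.symmCompOfNondegenerate_left_apply θ hnd y x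
  have hleib : ∀ x y, (A + LinearMap.id : l →ₗ[K] l) ⁅x, y⁆ =
      ⁅x, (A + LinearMap.id : l →ₗ[K] l) y⁆ - ⁅y, (A + LinearMap.id : l →ₗ[K] l) x⁆ := by
    intro x y
    rw [← sub_eq_zero]
    refine hnd.1 _ fun w ↦ ?_
    have h₁ := h x y w
    have h₂ : killingForm K l ⁅x, A y⁆ w = θ ⁅x, w⁆ y := by
      rw [hinv', hA, hskew, neg_neg]
    have h₃ : killingForm K l ⁅y, A x⁆ w = θ ⁅y, w⁆ x := by
      rw [hinv', hA, hskew, neg_neg]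
    have h₄ := hinv x y w
    have h₅ : killingForm K l ⁅y, x⁆ w = -killingForm K l x ⁅y, w⁆ := hinv' y x w
    simp only [LinearMap.add_apply, LinearMap.id_apply, lie_add, map_sub, map_add,
      LinearMap.sub_apply, hA, h₂, h₃, h₄, h₅]
    linear_combination -h₁
  obtain ⟨u, hu⟩ := LieDerivation.IsKilling.exists_eq_ad (R := K) (L := l)
    { toLinearMap := A + LinearMap.id, leibniz' := hleib }
  have hu' : ∀ x, ⁅u, x⁆ = A x + x := fun x ↦ by
    simpa using LieDerivation.congr_fun hu x
  have hzero : ∀ x y, killingForm K l x y = 0 := by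
    intro x y
    have h₁ := hinv' u x y
    rw [hu', hu', map_add, map_add, LinearMap.add_apply, hA, hcomm x (A y), hA, hskew y x] at h₁
    have h₂ : (2 : K) * killingForm K l x y = 0 := by linear_combination h₁
    exact (mul_eq_zero.mp h₂).resolve_left two_ne_zero
  exact subsingleton_of_forall_eq 0 fun x ↦ hnd.1 x (hzero x)

/-- A nonabelian reductive Lie algebra `g = z × l` (with `z` a finite-dimensional abelian
Lie algebra with a nondegenerate symmetric bilinear form `B`, and `l` a nontrivial
finite-dimensional semisimple Lie algebra with Killing form), equipped with the quadratic
form `κ((z₁,l₁),(z₂,l₂)) = B(z₁,z₂) + κ_l(l₁,l₂)`, is a quadratic Lie algebra (`κ` is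
nondegenerate, symmetric and invariant) which is Cartan-3-regular: the Cartan 3-cocycle
is not a coboundary of any alternating bilinear form. -/
theorem nonabelian_reductive_cartan_three_regular
    (K : Type*) [Field K] [CharZero K]
    (z : Type*) [LieRing z] [LieAlgebra K z] [IsLieAbelian z] [Module.Finite K z]
    (l : Type*) [LieRing l] [LieAlgebra K l] [Module.Finite K l]
    [LieAlgebra.IsSemisimple K l] [Nontrivial l]
    (B : z →ₗ[K] z →ₗ[K] K)
    (hBsymm : ∀ x y : z, B x y = B y x)
    (hBnondeg : ∀ x : z, (∀ y : z, B x y = 0) → x = 0) :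
    ∀ κ : (z × l) →ₗ[K] (z × l) →ₗ[K] K,
      κ = B.compl₁₂ (LinearMap.fst K z l) (LinearMap.fst K z l)
          + (killingForm K l).compl₁₂ (LinearMap.snd K z l) (LinearMap.snd K z l) →
      (∀ x y : z × l, κ x y = κ y x) ∧
      (∀ x : z × l, (∀ y : z × l, κ x y = 0) → x = 0) ∧
      (∀ x y w : z × l, κ ⁅x, y⁆ w = κ x ⁅y, w⁆) ∧
      ¬ ∃ θ : (z × l) →ₗ[K] (z × l) →ₗ[K] K, (∀ x : z × l, θ x x = 0) ∧
          ∀ x y w : z × l, κ x ⁅y, w⁆ = θ ⁅x, y⁆ w - θ ⁅x, w⁆ y + θ ⁅y, w⁆ x := by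
  rintro κ rfl
  have hinv : ∀ x y w : l, killingForm K l ⁅x, y⁆ w = killingForm K l x ⁅y, w⁆ :=
    LieModule.traceForm_apply_lie_apply K l l
  have hbr : ∀ x y : z × l, ⁅x, y⁆ = (0, ⁅x.2, y.2⁆) := fun x y ↦
    Prod.ext (trivial_lie_zero z z x.1 y.1) rfl
  refine ⟨fun x y ↦ ?_, fun x hx ↦ ?_, fun x y w ↦ ?_, ?_⟩
  · simp [hBsymm x.1 y.1, LieModule.traceForm_comm K l l x.2 y.2]
  · refine Prod.ext (hBnondeg _ fun y ↦ ?_)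
      ((LieAlgebra.IsKilling.killingForm_nondegenerate K l).1 _ fun y ↦ ?_)
    · simpa using hx (y, 0)
    · simpa using hx (0, y)
  · simp [hbr, hinv]
  · rintro ⟨θ, hθ, h⟩
    refine not_subsingleton l <|
      LieAlgebra.IsKilling.subsingleton_of_killingForm_eq_coboundary (K := K)
        (θ.compl₁₂ (LinearMap.inr K z l) (LinearMap.inr K z l)) (fun x ↦ hθ _) fun x y w ↦ ?_
    simpa [hbr] using h (0, x) (0, y) (0, w)
end

section
/- Let K be a field of characteristic 0 and V a K-vector space of finite dimension N ≥ 2. Then every K-linear derivation D of the tensor algebra T(V) can be written uniquely as D = ad_a + D', where a ∈ T(V) has vanishing constant term (i.e. a lies in the augmentation ideal T(V)⁺ = ⊕_{n≥1} V^{⊗n}), ad_a(y) = ay − ya, and D' is a derivation of T(V) such that for every n ≥ 1 the component in Hom_K(V, V^{⊗(n+1)}) of the restriction of D' to V lies in the kernel of the first-factor partial trace S_n. -/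
/-- Projection of the tensor algebra `T(V)` onto its graded component of tensor degree
`n` (along the canonical grading of `T(V)`). -/
noncomputable def tensorGradeProj (K : Type*) [Field K] (V : Type*) [AddCommGroup V]
    [Module K V] (n : ℕ) : TensorAlgebra K V →ₗ[K] TensorAlgebra K V :=
  (Submodule.subtype (LinearMap.range (TensorAlgebra.ι K (M := V)) ^ n))
    ∘ₗ (DirectSum.component K ℕ
        (fun i : ℕ => ↥(LinearMap.range (TensorAlgebra.ι K (M := V)) ^ i)) n)
    ∘ₗ (DirectSum.decomposeLinearEquiv
        (fun i : ℕ => LinearMap.range (TensorAlgebra.ι K (M := V)) ^ i)).toLinearMap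

section PartialTrace

open TensorAlgebra

/-- The degreewise characterization of the first-factor partial trace on `Hom_K(V, T(V))`. -/
def IsFirstFactorTrace {K : Type*} [Field K] {V : Type*} [AddCommGroup V] [Module K V]
    (S : (V →ₗ[K] TensorAlgebra K V) →ₗ[K] TensorAlgebra K V) : Prop :=
  ∀ (α : V →ₗ[K] K) (w₀ : V) (ws : List V), ws ≠ [] →
    S (α.smulRight (((w₀ :: ws).map (ι K)).prod)) = α w₀ • ((ws.map (ι K)).prod)

/-- The endomorphism of `T(V)` sending `a` to the partial trace of `v ↦ a * v`; in positive degrees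
it is the cyclic rotation of tensor factors. -/
noncomputable def tensorRotation {K : Type*} [Field K] {V : Type*} [AddCommGroup V] [Module K V]
    (S : (V →ₗ[K] TensorAlgebra K V) →ₗ[K] TensorAlgebra K V) :
    Module.End K (TensorAlgebra K V) :=
  S ∘ₗ (LinearMap.mul K (TensorAlgebra K V)).compl₂ (ι K)

variable {K : Type*} [Field K] {V : Type*} [AddCommGroup V] [Module K V]

theorem tensorGradeProj_apply (n : ℕ) (x : TensorAlgebra K V) :
    tensorGradeProj K V n x =
      DirectSum.decompose (fun i : ℕ => LinearMap.range (ι K (M := V)) ^ i) x n := rfl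

theorem tensorGradeProj_mem (n : ℕ) (x : TensorAlgebra K V) :
    tensorGradeProj K V n x ∈ LinearMap.range (ι K (M := V)) ^ n :=
  Subtype.property _

theorem tensorGradeProj_of_mem {n : ℕ} {x : TensorAlgebra K V}
    (hx : x ∈ LinearMap.range (ι K (M := V)) ^ n) (m : ℕ) :
    tensorGradeProj K V m x = if n = m then x else 0 := by
  rw [tensorGradeProj_apply]
  split_ifs with h
  · subst h
    exact DirectSum.decompose_of_mem_same (fun i : ℕ => LinearMap.range (ι K (M := V)) ^ i) hx
  · exact DirectSum.decompose_of_mem_ne (fun i : ℕ => LinearMap.range (ι K (M := V)) ^ i) hx h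

theorem eq_zero_of_tensorGradeProj {x : TensorAlgebra K V}
    (h : ∀ n, tensorGradeProj K V n x = 0) : x = 0 := by
  apply (DirectSum.decompose (fun i : ℕ => LinearMap.range (ι K (M := V)) ^ i)).injective
  rw [DirectSum.decompose_zero]
  ext n
  exact h n

theorem ι_mem_pow_one (v : V) : ι K v ∈ LinearMap.range (ι K (M := V)) ^ 1 := by
  rw [pow_one]
  exact LinearMap.mem_range_self _ v

theorem exists_forall_tensorGradeProj_eq_zero (x : TensorAlgebra K V) :
    ∃ M, ∀ n, M < n → tensorGradeProj K V n x = 0 := by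
  classical
  refine ⟨(DirectSum.decompose (fun i : ℕ => LinearMap.range (ι K (M := V)) ^ i) x).support.sup id,
    fun n hn => ?_⟩
  by_contra h
  rw [tensorGradeProj_apply, ZeroMemClass.coe_eq_zero] at h
  exact absurd (Finset.le_sup (f := id) (DFinsupp.mem_support_iff.2 h)) (not_le.2 hn)

theorem exists_forall_tensorGradeProj_comp_eq_zero [Module.Finite K V]
    (f : V →ₗ[K] TensorAlgebra K V) :
    ∃ M, ∀ n, M < n → tensorGradeProj K V n ∘ₗ f = 0 := by
  let b := Module.finBasis K V
  choose M hM using fun i => exists_forall_tensorGradeProj_eq_zero (f (b i))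
  refine ⟨Finset.univ.sup M, fun n hn => b.ext fun i => ?_⟩
  exact hM i n ((Finset.le_sup (Finset.mem_univ i)).trans_lt hn)

theorem tensorGradeProj_comp_ad (n : ℕ) (a : TensorAlgebra K V) :
    tensorGradeProj K V (n + 1) ∘ₗ (LinearMap.mulLeft K a - LinearMap.mulRight K a) ∘ₗ ι K =
      (LinearMap.mulLeft K (tensorGradeProj K V n a) -
        LinearMap.mulRight K (tensorGradeProj K V n a)) ∘ₗ ι K := by
  ext v
  have hl := DirectSum.coe_decompose_mul_add_of_right_mem
    (fun i : ℕ => LinearMap.range (ι K (M := V)) ^ i) (i := n) (a := a) (ι_mem_pow_one v)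
  have hr := DirectSum.coe_decompose_mul_add_of_left_mem
    (fun i : ℕ => LinearMap.range (ι K (M := V)) ^ i) (j := n) (b := a) (ι_mem_pow_one v)
  rw [add_comm] at hr
  simp only [LinearMap.comp_apply, LinearMap.sub_apply, LinearMap.mulLeft_apply,
    LinearMap.mulRight_apply, map_sub]
  exact congrArg₂ (· - ·) hl hr

variable {S : (V →ₗ[K] TensorAlgebra K V) →ₗ[K] TensorAlgebra K V}

theorem smulRight_add (α : V →ₗ[K] K) (x y : TensorAlgebra K V) :
    α.smulRight (x + y) = α.smulRight x + α.smulRight y :=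
  map_add (LinearMap.smulRightₗ α) x y

theorem smulRight_smul (α : V →ₗ[K] K) (r : K) (x : TensorAlgebra K V) :
    α.smulRight (r • x) = r • α.smulRight x :=
  map_smul (LinearMap.smulRightₗ α) r x

theorem tensorRotation_apply (a : TensorAlgebra K V) :
    tensorRotation S a = S (LinearMap.mulLeft K a ∘ₗ ι K) := rfl

theorem range_ι_pow_le_span (m : ℕ) :
    LinearMap.range (ι K (M := V)) ^ m ≤
      Submodule.span K {y | ∃ l : List V, l.length = m ∧ (l.map (ι K)).prod = y} := by
  induction m with
  | zero =>
    rw [pow_zero, Submodule.one_eq_span, Submodule.span_le]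
    rintro _ rfl
    exact Submodule.subset_span ⟨[], rfl, rfl⟩
  | succ m ih =>
    rw [pow_succ']
    refine (mul_le_mul_right ih _).trans (Submodule.mul_le.2 ?_)
    rintro _ ⟨v, rfl⟩ y hy
    induction hy using Submodule.span_induction with
    | mem y h =>
      obtain ⟨l, hl, rfl⟩ := h
      exact Submodule.subset_span ⟨v :: l, by simp [hl], by simp⟩
    | zero => simp
    | add y z _ _ hy hz => simpa only [mul_add] using add_mem hy hz
    | smul r y _ hy => simpa only [mul_smul_comm] using Submodule.smul_mem _ r hy

theorem IsFirstFactorTrace.smulRight_ι_mul (hS : IsFirstFactorTrace S) (α : V →ₗ[K] K) (w : V)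
    {n : ℕ} {x : TensorAlgebra K V} (hx : x ∈ LinearMap.range (ι K (M := V)) ^ (n + 1)) :
    S (α.smulRight (ι K w * x)) = α w • x := by
  replace hx := range_ι_pow_le_span _ hx
  induction hx using Submodule.span_induction with
  | mem y h =>
    obtain ⟨l, hl, rfl⟩ := h
    simpa using hS α w l (by rintro rfl; simp at hl)
  | zero => simp
  | add y z _ _ hy hz =>
    rw [mul_add, smulRight_add, map_add, hy, hz, smul_add]
  | smul r y _ hy =>
    rw [mul_smul_comm, smulRight_smul, map_smul, hy, smul_comm]

theorem one_sub_finrank_pow_ne_zero [CharZero K] (hdim : 2 ≤ Module.finrank K V)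
    (n : ℕ) : 1 - (Module.finrank K V : K) ^ (n + 1) ≠ 0 := by
  rw [sub_ne_zero]
  exact_mod_cast (Nat.one_lt_pow n.succ_ne_zero hdim).ne

section Finite

variable [Module.Finite K V]

theorem eq_sum_coord_smulRight (f : V →ₗ[K] TensorAlgebra K V) :
    f = ∑ i, ((Module.finBasis K V).coord i).smulRight (f (Module.finBasis K V i)) := by
  ext v
  conv_lhs => rw [← (Module.finBasis K V).sum_repr v]
  simp only [map_sum, map_smul, LinearMap.sum_apply, LinearMap.smulRight_apply,
    Module.Basis.coord_apply]

theorem IsFirstFactorTrace.mulRight (hS : IsFirstFactorTrace S) {n : ℕ} {x : TensorAlgebra K V}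
    (hx : x ∈ LinearMap.range (ι K (M := V)) ^ (n + 1)) :
    S (LinearMap.mulRight K x ∘ₗ ι K) = (Module.finrank K V : K) • x := by
  rw [eq_sum_coord_smulRight (LinearMap.mulRight K x ∘ₗ ι K), map_sum]
  simp [hS.smulRight_ι_mul _ _ hx, ← Nat.cast_smul_eq_nsmul K]

theorem IsFirstFactorTrace.tensorRotation_ι_mul (hS : IsFirstFactorTrace S) (w : V) {n : ℕ}
    {x : TensorAlgebra K V} (hx : x ∈ LinearMap.range (ι K (M := V)) ^ n) :
    tensorRotation S (ι K w * x) = x * ι K w := by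
  have hmem (v : V) : x * ι K v ∈ LinearMap.range (ι K (M := V)) ^ (n + 1) := by
    rw [pow_succ]
    exact Submodule.mul_mem_mul hx (LinearMap.mem_range_self _ v)
  rw [tensorRotation_apply, eq_sum_coord_smulRight (LinearMap.mulLeft K (ι K w * x) ∘ₗ ι K), map_sum]
  simp only [LinearMap.comp_apply, LinearMap.mulLeft_apply, mul_assoc,
    hS.smulRight_ι_mul _ _ (hmem _)]
  conv_rhs => rw [← (Module.finBasis K V).sum_repr w]
  simp only [map_sum, map_smul, Finset.mul_sum, mul_smul_comm, Module.Basis.coord_apply]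

theorem IsFirstFactorTrace.map_mem (hS : IsFirstFactorTrace S) {n : ℕ}
    {f : V →ₗ[K] TensorAlgebra K V} (hf : ∀ v, f v ∈ LinearMap.range (ι K (M := V)) ^ (n + 2)) :
    S f ∈ LinearMap.range (ι K (M := V)) ^ (n + 1) := by
  rw [eq_sum_coord_smulRight f, map_sum]
  refine Submodule.sum_mem _ fun i _ => ?_
  have h := hf (Module.finBasis K V i)
  rw [pow_succ'] at h
  generalize f (Module.finBasis K V i) = x at h
  induction h using Submodule.mul_induction_on' with
  | mem_mul_mem y hy z hz =>
    obtain ⟨w, rfl⟩ := hy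
    rw [hS.smulRight_ι_mul _ _ hz]
    exact Submodule.smul_mem _ _ hz
  | add y _ z _ hy hz =>
    rw [smulRight_add, map_add]
    exact add_mem hy hz

theorem IsFirstFactorTrace.tensorRotation_mem (hS : IsFirstFactorTrace S) {n : ℕ}
    {x : TensorAlgebra K V} (hx : x ∈ LinearMap.range (ι K (M := V)) ^ (n + 1)) :
    tensorRotation S x ∈ LinearMap.range (ι K (M := V)) ^ (n + 1) := by
  refine hS.map_mem fun v => ?_
  rw [pow_succ _ (n + 1)]
  exact Submodule.mul_mem_mul hx (LinearMap.mem_range_self _ v)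

theorem IsFirstFactorTrace.tensorRotation_pow_mul (hS : IsFirstFactorTrace S) {m n : ℕ}
    {x y : TensorAlgebra K V} (hx : x ∈ LinearMap.range (ι K (M := V)) ^ n)
    (hy : y ∈ LinearMap.range (ι K (M := V)) ^ m) :
    (tensorRotation S ^ n) (x * y) = y * x := by
  induction hx using Submodule.pow_induction_on_left' generalizing m y with
  | algebraMap r => simpa using Algebra.commutes r y
  | add x z i _ _ hx hz => simp [add_mul, mul_add, hx hy, hz hy]
  | mem_mul a ha i x hx ih =>
    obtain ⟨w, rfl⟩ := ha
    have hxy := Submodule.mul_mem_mul hx hy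
    rw [← pow_add] at hxy
    have hyw := Submodule.mul_mem_mul hy (LinearMap.mem_range_self (ι K) w)
    rw [← pow_succ] at hyw
    rw [Nat.succ_eq_add_one, pow_succ, Module.End.mul_apply, mul_assoc, hS.tensorRotation_ι_mul w hxy,
      mul_assoc, ih hyw, mul_assoc]

theorem IsFirstFactorTrace.tensorRotation_pow_apply (hS : IsFirstFactorTrace S) {n : ℕ}
    {x : TensorAlgebra K V} (hx : x ∈ LinearMap.range (ι K (M := V)) ^ n) :
    (tensorRotation S ^ n) x = x := by
  simpa using hS.tensorRotation_pow_mul hx (m := 0) (y := 1) (by simp)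

theorem IsFirstFactorTrace.ad (hS : IsFirstFactorTrace S) {n : ℕ} {x : TensorAlgebra K V}
    (hx : x ∈ LinearMap.range (ι K (M := V)) ^ (n + 1)) :
    S ((LinearMap.mulLeft K x - LinearMap.mulRight K x) ∘ₗ ι K) =
      (tensorRotation S - (Module.finrank K V : Module.End K (TensorAlgebra K V))) x := by
  rw [LinearMap.sub_comp, map_sub, hS.mulRight hx, LinearMap.sub_apply, tensorRotation_apply,
    Module.End.natCast_apply, Nat.cast_smul_eq_nsmul]

theorem IsFirstFactorTrace.tensorRotation_pow_sub_apply (hS : IsFirstFactorTrace S) {n : ℕ}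
    {x : TensorAlgebra K V} (hx : x ∈ LinearMap.range (ι K (M := V)) ^ n) :
    (tensorRotation S ^ n - (Module.finrank K V : Module.End K (TensorAlgebra K V)) ^ n) x =
      (1 - (Module.finrank K V : K) ^ n) • x := by
  rw [LinearMap.sub_apply, hS.tensorRotation_pow_apply hx, sub_smul, one_smul, ← Nat.cast_pow,
    Module.End.natCast_apply, ← Nat.cast_pow, Nat.cast_smul_eq_nsmul]

variable [CharZero K]

theorem IsFirstFactorTrace.eq_zero_of_ad (hS : IsFirstFactorTrace S)
    (hdim : 2 ≤ Module.finrank K V) {n : ℕ} {x : TensorAlgebra K V}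
    (hx : x ∈ LinearMap.range (ι K (M := V)) ^ (n + 1))
    (h : S ((LinearMap.mulLeft K x - LinearMap.mulRight K x) ∘ₗ ι K) = 0) : x = 0 := by
  rw [hS.ad hx] at h
  have hgeom := LinearMap.congr_fun
    ((Nat.cast_commute (Module.finrank K V) (tensorRotation S)).symm.geom_sum₂_mul (n + 1)) x
  rw [Module.End.mul_apply, h, map_zero, hS.tensorRotation_pow_sub_apply hx] at hgeom
  exact (smul_eq_zero.1 hgeom.symm).resolve_left (one_sub_finrank_pow_ne_zero hdim n)

theorem IsFirstFactorTrace.exists_ad_eq (hS : IsFirstFactorTrace S)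
    (hdim : 2 ≤ Module.finrank K V) {n : ℕ} {y : TensorAlgebra K V}
    (hy : y ∈ LinearMap.range (ι K (M := V)) ^ (n + 1)) :
    ∃ x ∈ LinearMap.range (ι K (M := V)) ^ (n + 1),
      S ((LinearMap.mulLeft K x - LinearMap.mulRight K x) ∘ₗ ι K) = y := by
  have hgeom := LinearMap.congr_fun
    ((Nat.cast_commute (Module.finrank K V) (tensorRotation S)).symm.mul_geom_sum₂ (n + 1)) y
  rw [Module.End.mul_apply, hS.tensorRotation_pow_sub_apply hy] at hgeom
  set z := (∑ i ∈ Finset.range (n + 1), tensorRotation S ^ i *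
    (Module.finrank K V : Module.End K (TensorAlgebra K V)) ^ (n + 1 - 1 - i)) y with hz
  have hpow : ∀ i, ∀ u ∈ LinearMap.range (ι K (M := V)) ^ (n + 1),
      (tensorRotation S ^ i) u ∈ LinearMap.range (ι K (M := V)) ^ (n + 1) := fun i u hu => by
    rw [Module.End.pow_apply]
    exact Set.MapsTo.iterate (fun _ => hS.tensorRotation_mem) i hu
  have hzmem : z ∈ LinearMap.range (ι K (M := V)) ^ (n + 1) := by
    rw [hz, LinearMap.sum_apply]
    refine Submodule.sum_mem _ fun i _ => ?_
    rw [Module.End.mul_apply, ← Nat.cast_pow, Module.End.natCast_apply]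
    exact hpow i _ (nsmul_mem hy _)
  refine ⟨(1 - (Module.finrank K V : K) ^ (n + 1))⁻¹ • z, Submodule.smul_mem _ _ hzmem, ?_⟩
  rw [hS.ad (Submodule.smul_mem _ _ hzmem), map_smul, hgeom,
    inv_smul_smul₀ (one_sub_finrank_pow_ne_zero hdim n)]

/-- The inner part of a linear map: some `a` in the augmentation ideal has `ad_a` with the same
partial traces as `f`. -/
theorem IsFirstFactorTrace.exists_inner (hS : IsFirstFactorTrace S)
    (hdim : 2 ≤ Module.finrank K V) (f : V →ₗ[K] TensorAlgebra K V) :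
    ∃ a, tensorGradeProj K V 0 a = 0 ∧ ∀ n, 1 ≤ n →
      S (tensorGradeProj K V (n + 1) ∘ₗ (LinearMap.mulLeft K a - LinearMap.mulRight K a) ∘ₗ ι K) =
        S (tensorGradeProj K V (n + 1) ∘ₗ f) := by
  choose c hc hcS using fun n => hS.exists_ad_eq hdim
    (hS.map_mem (n := n) (f := tensorGradeProj K V (n + 2) ∘ₗ f)
      fun v => tensorGradeProj_mem _ _)
  obtain ⟨M, hM⟩ := exists_forall_tensorGradeProj_comp_eq_zero f
  refine ⟨∑ i ∈ Finset.range M, c i, ?_, ?_⟩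
  · rw [map_sum]
    exact Finset.sum_eq_zero fun i _ => by simp [tensorGradeProj_of_mem (hc i)]
  · intro n hn
    obtain ⟨k, rfl⟩ := Nat.exists_eq_add_of_le' hn
    have hcomp : tensorGradeProj K V (k + 1) (∑ i ∈ Finset.range M, c i) = c k := by
      simp only [map_sum, tensorGradeProj_of_mem (hc _), add_left_inj, Finset.sum_ite_eq',
        Finset.mem_range, ite_eq_left_iff, not_lt]
      intro hk
      refine (hS.eq_zero_of_ad hdim (hc k) ?_).symm
      rw [hcS, hM _ (by omega), map_zero]
    rw [tensorGradeProj_comp_ad, hcomp, hcS]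

end Finite

end PartialTrace

/-- Every derivation `D` of the tensor algebra `T(V)` of a vector space of finite
dimension `≥ 2` over a field of characteristic zero can be written uniquely as
`D = ad_a + D'`, with `a ∈ T(V)` of vanishing constant term, `ad_a y = ay − ya`, and `D'`
a derivation whose restriction to `V` has, in each tensor degree `n + 1` with `n ≥ 1`,
its component annihilated by the first-factor partial trace `S_n`. -/
theorem derivation_unique_decomposition_inner_plus_traceless
    (K : Type*) [Field K] [CharZero K]
    (V : Type*) [AddCommGroup V] [Module K V] [Module.Finite K V]
    (hdim : 2 ≤ Module.finrank K V)
    -- the first-factor partial trace (on all of `Hom_K(V, T(V))` at once, characterized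
    -- degreewise on maps `v ↦ α(v)·(ι w₀ ⋯ ι w_n)` with `n ≥ 1`)
    (S : (V →ₗ[K] TensorAlgebra K V) →ₗ[K] TensorAlgebra K V)
    (hS : ∀ (α : V →ₗ[K] K) (w₀ : V) (ws : List V), ws ≠ [] →
        S (α.smulRight (((w₀ :: ws).map (TensorAlgebra.ι K)).prod))
          = α w₀ • ((ws.map (TensorAlgebra.ι K)).prod))
    (D : TensorAlgebra K V →ₗ[K] TensorAlgebra K V)
    (hD : ∀ a b : TensorAlgebra K V, D (a * b) = D a * b + a * D b) :
    ∃! p : TensorAlgebra K V × (TensorAlgebra K V →ₗ[K] TensorAlgebra K V),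
      -- `a = p.1` has vanishing constant term, i.e. lies in the augmentation ideal
      tensorGradeProj K V 0 p.1 = 0 ∧
      -- `D' = p.2` is a derivation
      (∀ a b : TensorAlgebra K V, p.2 (a * b) = p.2 a * b + a * p.2 b) ∧
      -- `D = ad_a + D'`
      D = (LinearMap.mulLeft K p.1 - LinearMap.mulRight K p.1) + p.2 ∧
      -- for every `n ≥ 1`, the component in tensor degree `n + 1` of the restriction of
      -- `D'` to `V` lies in the kernel of the first-factor partial trace
      (∀ n : ℕ, 1 ≤ n →
        S ((tensorGradeProj K V (n + 1)) ∘ₗ p.2 ∘ₗ (TensorAlgebra.ι K)) = 0) := by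
  have htrace : IsFirstFactorTrace S := hS
  obtain ⟨a, ha₀, ha⟩ := htrace.exists_inner hdim (D ∘ₗ TensorAlgebra.ι K)
  refine ⟨(a, D - (LinearMap.mulLeft K a - LinearMap.mulRight K a)),
    ⟨ha₀, fun x y => ?_, (add_sub_cancel _ _).symm, fun n hn => ?_⟩, ?_⟩
  · simp only [LinearMap.sub_apply, LinearMap.mulLeft_apply, LinearMap.mulRight_apply, hD]
    noncomm_ring
  · rw [LinearMap.sub_comp, LinearMap.comp_sub, map_sub, ha n hn, sub_self]
  · rintro ⟨b, E⟩ ⟨hb₀, -, hDE, hE⟩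
    dsimp only at hb₀ hDE hE
    have hb : b - a = 0 := by
      refine eq_zero_of_tensorGradeProj fun n => ?_
      rcases n with _ | n
      · rw [map_sub, hb₀, ha₀, sub_self]
      · refine htrace.eq_zero_of_ad hdim (tensorGradeProj_mem _ _) ?_
        have hn := ha (n + 1) (by omega)
        rw [hDE, LinearMap.add_comp, LinearMap.comp_add, map_add, hE (n + 1) (by omega), add_zero,
          tensorGradeProj_comp_ad, tensorGradeProj_comp_ad] at hn
        rw [map_sub, ← sub_eq_zero.2 hn.symm, ← map_sub S]
        refine congrArg S (LinearMap.ext fun v => ?_)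
        simp only [LinearMap.comp_apply, LinearMap.sub_apply, LinearMap.mulLeft_apply,
          LinearMap.mulRight_apply]
        noncomm_ring
    obtain rfl := sub_eq_zero.1 hb
    rw [hDE, add_sub_cancel_left]
end

section
/- Let K be a field, V a K-vector space, and W ⊆ V a subspace with 2 ≤ dim_K W < ∞. Let A ⊆ T(V) be the subalgebra of the tensor algebra T(V) generated by W (the image of T(W) under the algebra embedding induced by the inclusion W ⊆ V). Then for every c ∈ T(V): the inner derivation ad_c(y) = cy − yc maps A into A if and only if c ∈ A. -/
open MonoidAlgebra in
/-- Membership in the subalgebra of the algebra of noncommutative polynomials generated by the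
variables in `S`: every monomial that occurs is a word in `S`. -/
theorem MonoidAlgebra.mem_adjoin_single_of_iff {K κ : Type*} [CommSemiring K] (S : Set κ)
    (x : MonoidAlgebra K (FreeMonoid κ)) :
    x ∈ Algebra.adjoin K ((fun i => single (FreeMonoid.of i) (1 : K)) '' S) ↔
      ∀ u, x.coeff u ≠ 0 → ∀ i ∈ u.toList, i ∈ S := by
  classical
  constructor
  · intro hx
    induction hx using Algebra.adjoin_induction with
    | mem x hx =>
      obtain ⟨i, hi, rfl⟩ := hx
      intro u hu j hj
      rw [coeff_single, Finsupp.single_apply] at hu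
      split_ifs at hu with h
      · subst h
        simp only [FreeMonoid.toList_of, List.mem_singleton] at hj
        exact hj ▸ hi
      · exact absurd rfl hu
    | algebraMap r =>
      intro u hu j hj
      rw [coe_algebraMap, Function.comp_apply, coeff_single, Finsupp.single_apply] at hu
      split_ifs at hu with h
      · subst h
        simp at hj
      · exact absurd rfl hu
    | add x y _ _ hx hy =>
      intro u hu
      by_cases h : x.coeff u = 0
      · exact hy u fun h' => hu (by simp [h, h'])
      · exact hx u h
    | mul x y _ _ hx hy =>
      intro u hu
      obtain ⟨v, hv, w, hw, rfl⟩ := Finset.mem_mul.1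
        (support_coeff_mul_subset x y (Finsupp.mem_support_iff.2 hu))
      intro i hi
      rw [FreeMonoid.toList_mul, List.mem_append] at hi
      exact hi.elim (hx v (Finsupp.mem_support_iff.1 hv) i)
        (hy w (Finsupp.mem_support_iff.1 hw) i)
  · have single_mem (u : FreeMonoid κ) (hu : ∀ i ∈ u.toList, i ∈ S) :
        single u (1 : K) ∈ Algebra.adjoin K ((fun i => single (FreeMonoid.of i) (1 : K)) '' S) := by
      induction u using FreeMonoid.inductionOn' with
      | one => exact one_mem _
      | of_mul i u ih =>
        have h := mul_mem
          (Algebra.subset_adjoin (R := K) (Set.mem_image_of_mem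
            (fun i => single (FreeMonoid.of i) (1 : K)) (hu i (by simp))))
          (ih fun j hj => hu j (by simp [hj]))
        simpa using h
    intro hx
    rw [← Subalgebra.mem_toSubmodule]
    refine Submodule.span_le.2 ?_ (mem_span_support_coeff x)
    rintro _ ⟨u, hu, rfl⟩
    exact single_mem u (hx u (Finsupp.mem_support_iff.1 hu))

open MonoidAlgebra in
/-- If the commutator of `x` with a variable in `S` is a noncommutative polynomial in the variables
in `S`, then so is `x`. -/
theorem MonoidAlgebra.mem_adjoin_single_of_commutator_mem {K κ : Type*} [CommRing K] {S : Set κ}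
    {i : κ} (hi : i ∈ S) {x : MonoidAlgebra K (FreeMonoid κ)}
    (hx : x * single (FreeMonoid.of i) 1 - single (FreeMonoid.of i) 1 * x ∈
      Algebra.adjoin K ((fun i => single (FreeMonoid.of i) (1 : K)) '' S)) :
    x ∈ Algebra.adjoin K ((fun i => single (FreeMonoid.of i) (1 : K)) '' S) := by
  rw [mem_adjoin_single_of_iff] at hx ⊢
  have coeff_rotate (u : FreeMonoid κ) (hu : ¬ ∀ j ∈ u.toList, j ∈ S) :
      (x * single (FreeMonoid.of i) 1).coeff (FreeMonoid.of i * u) = x.coeff u := by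
    have h : (single (FreeMonoid.of i) 1 * x).coeff (FreeMonoid.of i * u) = x.coeff u := by
      rw [coeff_single_mul_eq_mul_coeff u (fun _ _ => mul_right_inj _), one_mul]
    have h' := not_imp_comm.1 (hx (FreeMonoid.of i * u))
      fun h => hu fun j hj => h j (by simp [hj])
    rw [coeff_sub, Finsupp.sub_apply, h, sub_eq_zero] at h'
    exact h'
  have suffix_mem (w v : List κ) (hc : x.coeff (FreeMonoid.ofList (v ++ w)) ≠ 0)
      (hv : ¬ ∀ j ∈ v ++ w, j ∈ S) : ∀ j ∈ w, j ∈ S := by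
    induction w using List.reverseRecOn generalizing v with
    | nil => simp
    | append_singleton w y ih =>
      rw [← coeff_rotate (FreeMonoid.ofList (v ++ (w ++ [y]))) hv] at hc
      have hy : y = i := by
        by_contra hne
        refine hc (coeff_mul_single_of_forall_mul_ne _ _ fun d hd => hne ?_)
        have := congrArg (fun l => (FreeMonoid.toList l).getLast?) hd
        simp [List.getLast?_cons] at this
        exact this.symm
      subst hy
      have hw : FreeMonoid.of y * FreeMonoid.ofList (v ++ (w ++ [y])) =
          FreeMonoid.ofList (y :: v ++ w) * FreeMonoid.of y := by
        apply FreeMonoid.toList.injective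
        simp
      rw [hw, coeff_mul_single_eq_coeff_mul _ (fun _ _ => mul_left_inj _), mul_one] at hc
      have := ih (y :: v) hc (by grind)
      grind
  intro u hu
  by_contra hS
  exact hS (suffix_mem u.toList [] hu hS)

universe u in
/-- A basis of a space `V` over a field, part of which spans a given subspace `W`. -/
theorem Submodule.exists_basis_span_image {K : Type*} {V : Type u} [Field K] [AddCommGroup V] [Module K V]
    (W : Submodule K V) :
    ∃ (κ : Type u) (b : Module.Basis κ K V) (S : Set κ), W = Submodule.span K (b '' S) := by
  obtain ⟨W', h⟩ := W.exists_isCompl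
  let bW := Module.Basis.ofVectorSpace K W
  let b := (bW.prod (Module.Basis.ofVectorSpace K W')).map (W.prodEquivOfIsCompl W' h)
  refine ⟨_, b, Set.range Sum.inl, ?_⟩
  have hb : b '' Set.range Sum.inl = W.subtype '' Set.range bW := by
    rw [← Set.range_comp, ← Set.range_comp]
    congr 1
    ext i
    simp [b]
  rw [hb, ← Submodule.map_span, bW.span_eq, Submodule.map_subtype_top]


/-- Let `W ⊆ V` be a subspace with `2 ≤ dim W < ∞` and `A ⊆ T(V)` the subalgebra of the
tensor algebra generated by `W`.  Then for `c ∈ T(V)`, the inner derivation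
`ad_c : y ↦ cy − yc` maps `A` into `A` if and only if `c ∈ A`. -/
theorem inner_derivation_preserves_subalgebra_iff
    (K : Type*) [Field K]
    (V : Type*) [AddCommGroup V] [Module K V]
    (W : Submodule K V) [Module.Finite K W] (hW : 2 ≤ Module.finrank K W)
    (c : TensorAlgebra K V) :
    (∀ y ∈ Algebra.adjoin K (⇑(TensorAlgebra.ι K) '' (W : Set V)),
        c * y - y * c ∈ Algebra.adjoin K (⇑(TensorAlgebra.ι K) '' (W : Set V))) ↔
      c ∈ Algebra.adjoin K (⇑(TensorAlgebra.ι K) '' (W : Set V)) := by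
  refine ⟨fun h => ?_, fun hc y hy => sub_mem (mul_mem hc hy) (mul_mem hy hc)⟩
  obtain ⟨κ, b, S, hbS⟩ := W.exists_basis_span_image
  obtain ⟨i, hi⟩ : S.Nonempty := by
    rw [Set.nonempty_iff_ne_empty]
    rintro rfl
    rw [Set.image_empty, Submodule.span_empty] at hbS
    subst hbS
    simp at hW
  let Φ : TensorAlgebra K V ≃ₐ[K] MonoidAlgebra K (FreeMonoid κ) :=
    (TensorAlgebra.equivFreeAlgebra b).trans FreeAlgebra.equivMonoidAlgebraFreeMonoid
  have map_basis (j : κ) :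
      Φ (TensorAlgebra.ι K (b j)) = MonoidAlgebra.single (FreeMonoid.of j) 1 := by
    simp [Φ, FreeAlgebra.equivMonoidAlgebraFreeMonoid]
  have mem_iff (y : TensorAlgebra K V) :
      y ∈ Algebra.adjoin K (⇑(TensorAlgebra.ι K) '' (W : Set V)) ↔
        Φ y ∈ Algebra.adjoin K
          ((fun j => MonoidAlgebra.single (FreeMonoid.of j) (1 : K)) '' S) := by
    have hS : (fun j => MonoidAlgebra.single (FreeMonoid.of j) (1 : K)) '' S =
        (Φ : TensorAlgebra K V →ₐ[K] _) '' (TensorAlgebra.ι K '' (b '' S)) := by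
      rw [Set.image_image, Set.image_image]
      exact Set.image_congr fun j _ => (map_basis j).symm
    rw [hS, ← AlgHom.map_adjoin, hbS, ← Submodule.map_coe, Submodule.map_span,
      Algebra.adjoin_span]
    exact (Φ.injective.mem_set_image (a := y)).symm
  have hb : TensorAlgebra.ι K (b i) ∈
      Algebra.adjoin K (⇑(TensorAlgebra.ι K) '' (W : Set V)) :=
    Algebra.subset_adjoin ⟨b i, hbS ▸ Submodule.subset_span ⟨i, hi, rfl⟩, rfl⟩
  have hc := (mem_iff _).1 (h _ hb)
  rw [map_sub, map_mul, map_mul, map_basis] at hc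
  exact (mem_iff c).2 (MonoidAlgebra.mem_adjoin_single_of_commutator_mem hi hc)
end
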